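/- Let (W,S) be a Coxeter system with S finite, let 𝒮 be the set of spherical subsets T ⊆ S, and for T ∈ 𝒮 let w_T be the longest element of W_T. Then in ℚ[[t]] (each growth series below has constant term 1 and hence is invertible): (Σ_{w∈W} t^{ℓ(w)})⁻¹ = Σ_{T∈𝒮} (−1)^{Card T} · t^{ℓ(w_T)} · (Σ_{w∈W_T} t^{ℓ(w)})⁻¹. (This is the single-parameter form of the identity 1/W(t⁻¹) = Σ_{T∈𝒮} (−1)^{Card T}/W_T(t), combined with the palindromy W_T(t) = t^{ℓ(w_T)} W_T(t⁻¹) for finite W_T.) -/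

import Mathlib

namespace CoxeterSystem

variable {B W : Type*} [Group W] {M : CoxeterMatrix B} (cs : CoxeterSystem M W)

/-! ### The exchange property -/

open scoped Classical in
/-- The involution `(t, e) ↦ (s t s, e + [t = s])` of `W × ℤ/2` attached to a simple
reflection `s`. -/
noncomputable def reflectionPerm (i : B) : Equiv.Perm (W × ZMod 2) :=
  Function.Involutive.toPerm
    (fun p => (cs.simple i * p.1 * cs.simple i, p.2 + if p.1 = cs.simple i then 1 else 0)) (by
      rintro ⟨t, e⟩
      have h : cs.simple i * t * cs.simple i = cs.simple i ↔ t = cs.simple i := by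
        constructor
        · intro h
          have := congrArg (fun x => cs.simple i * x * cs.simple i) h
          simpa [mul_assoc] using this
        · rintro rfl
          simp
      simp only [h, add_assoc, CharTwo.add_self_eq_zero, add_zero]
      simp [mul_assoc])

open scoped Classical in
theorem reflectionPerm_apply (i : B) (t : W) (e : ZMod 2) :
    cs.reflectionPerm i (t, e) =
      (cs.simple i * t * cs.simple i, e + if t = cs.simple i then 1 else 0) := rfl

open scoped Classical in
theorem reflectionPerm_mul_pow_apply (i j : B) (k : ℕ) (t : W) (e : ZMod 2) :
    ((cs.reflectionPerm i * cs.reflectionPerm j) ^ k) (t, e) =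
      ((cs.simple i * cs.simple j) ^ k * t * ((cs.simple i * cs.simple j) ^ k)⁻¹,
        e + ∑ q ∈ Finset.range (2 * k),
          if t = cs.simple j * (cs.simple i * cs.simple j) ^ q then 1 else 0) := by
  induction k with
  | zero => simp
  | succ k ih =>
    set c := cs.simple i * cs.simple j with hc
    have hcj : ∀ l : ℕ, (c ^ l)⁻¹ * cs.simple j = cs.simple j * c ^ l := by
      intro l
      have h1 : SemiconjBy (cs.simple j) c c⁻¹ := by
        simp [SemiconjBy, hc, mul_assoc]
      have h2 := h1.pow_right l
      rw [inv_pow] at h2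
      exact h2.eq.symm
    have e1 : c ^ k * t * (c ^ k)⁻¹ = cs.simple j ↔ t = cs.simple j * c ^ (2 * k) := by
      rw [two_mul, pow_add, ← mul_assoc, ← hcj, mul_inv_eq_iff_eq_mul, ← eq_inv_mul_iff_mul_eq,
        mul_assoc]
    have e2 : cs.simple j * (c ^ k * t * (c ^ k)⁻¹) * cs.simple j = cs.simple i ↔
        t = cs.simple j * c ^ (2 * k + 1) := by
      have : cs.simple j * c ^ (2 * k + 1) =
          (c ^ k)⁻¹ * (cs.simple j * cs.simple i * cs.simple j) * c ^ k := by
        rw [show 2 * k + 1 = k + 1 + k by ring, pow_add, pow_succ, ← mul_assoc, ← mul_assoc,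
          ← hcj, hc]
        simp only [mul_assoc]
      rw [this]
      constructor
      · intro h
        rw [← h]
        simp [mul_assoc]
      · rintro rfl
        simp [mul_assoc]
    rw [pow_succ', Equiv.Perm.mul_apply, ih, Equiv.Perm.mul_apply, reflectionPerm_apply,
      reflectionPerm_apply, show 2 * (k + 1) = 2 * k + 1 + 1 by ring, Finset.sum_range_succ,
      Finset.sum_range_succ]
    simp only [e1, e2]
    refine Prod.ext ?_ ?_
    · simp [pow_succ', hc, mul_assoc]
    · simp only [add_assoc]

theorem isLiftable_reflectionPerm : M.IsLiftable cs.reflectionPerm := by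
  classical
  intro i j
  ext1 ⟨t, e⟩
  rw [reflectionPerm_mul_pow_apply, cs.simple_mul_simple_pow, two_mul, Finset.sum_range_add]
  simp only [pow_add, cs.simple_mul_simple_pow, one_mul, CharTwo.add_self_eq_zero]
  simp

/-- The action of `W` on `W × ℤ/2` extending `reflectionPerm`. -/
noncomputable def reflectionAction : W →* Equiv.Perm (W × ZMod 2) :=
  cs.lift ⟨cs.reflectionPerm, cs.isLiftable_reflectionPerm⟩

theorem reflectionAction_simple (i : B) :
    cs.reflectionAction (cs.simple i) = cs.reflectionPerm i :=
  cs.lift_apply_simple cs.isLiftable_reflectionPerm i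

open scoped Classical in
theorem reflectionAction_wordProd (ω : List B) (t : W) (e : ZMod 2) :
    cs.reflectionAction (cs.wordProd ω) (t, e) =
      (cs.wordProd ω * t * (cs.wordProd ω)⁻¹, e + ((cs.rightInvSeq ω).count t : ZMod 2)) := by
  induction ω with
  | nil => simp
  | cons i ω ih =>
    have h : cs.wordProd ω * t * (cs.wordProd ω)⁻¹ = cs.simple i ↔
        (cs.wordProd ω)⁻¹ * cs.simple i * cs.wordProd ω = t := by
      constructor
      · intro h
        rw [← h]
        group
      · rintro rfl
        group
    rw [wordProd_cons, map_mul, Equiv.Perm.mul_apply, ih, reflectionAction_simple,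
      reflectionPerm_apply, rightInvSeq, List.count_cons]
    refine Prod.ext ?_ ?_
    · simp [mul_assoc]
    · simp [h, add_assoc]

/-- The exchange property, in terms of the right inversion sequence. -/
theorem simple_mem_rightInvSeq {ω : List B} {i : B}
    (h : cs.IsRightDescent (cs.wordProd ω) i) : cs.simple i ∈ cs.rightInvSeq ω := by
  classical
  by_contra hni
  obtain ⟨ω', hω', hω'e⟩ := cs.exists_isReduced (cs.wordProd ω * cs.simple i)
  have h1 := cs.reflectionAction_wordProd ω' (cs.simple i) 0
  rw [← hω'e, map_mul, Equiv.Perm.mul_apply, reflectionAction_simple, reflectionPerm_apply,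
    reflectionAction_wordProd, simple_mul_simple_self, one_mul,
    List.count_eq_zero_of_not_mem hni] at h1
  have h2 := congrArg Prod.snd h1
  have hmem : cs.simple i ∈ cs.rightInvSeq ω' := by
    by_contra hn
    rw [List.count_eq_zero_of_not_mem hn] at h2
    simp at h2
  have h3 := (cs.isRightInversion_of_mem_rightInvSeq hω' hmem).2
  rw [← hω'e, simple_mul_simple_cancel_right] at h3
  exact absurd h h3.not_gt

/-- The exchange property. -/
theorem exists_eraseIdx_of_isRightDescent {ω : List B} {i : B}
    (h : cs.IsRightDescent (cs.wordProd ω) i) :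
    ∃ j < ω.length, cs.wordProd ω * cs.simple i = cs.wordProd (ω.eraseIdx j) := by
  obtain ⟨j, hj, hji⟩ := List.mem_iff_getElem.mp (cs.simple_mem_rightInvSeq h)
  refine ⟨j, by simpa using hj, ?_⟩
  rw [← wordProd_mul_getD_rightInvSeq, List.getD_eq_getElem _ _ hj, hji]

/-- The exchange property for a product: if `i` is a right descent of `u * v`, then either it is
a right descent of `v`, or `u * v * s i = u' * v` with `u'` shorter than `u`. -/
theorem exchange_mul {u v : W} {i : B} (h : cs.IsRightDescent (u * v) i) :
    cs.IsRightDescent v i ∨ ∃ u', cs.length u' < cs.length u ∧ u * v * cs.simple i = u' * v := by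
  obtain ⟨α, hα, rfl⟩ := cs.exists_isReduced u
  obtain ⟨β, hβ, rfl⟩ := cs.exists_isReduced v
  rw [← wordProd_append] at h
  obtain ⟨j, hj, hji⟩ := cs.exists_eraseIdx_of_isRightDescent h
  rw [List.length_append] at hj
  rcases lt_or_ge j α.length with hjα | hjα
  · right
    refine ⟨cs.wordProd (α.eraseIdx j), ?_, ?_⟩
    · have := cs.length_wordProd_le (α.eraseIdx j)
      rw [List.length_eraseIdx_of_lt hjα] at this
      rw [hα.eq]
      omega
    · rw [← wordProd_append, hji, List.eraseIdx_append_of_lt_length hjα, wordProd_append]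
  · left
    rw [List.eraseIdx_append_of_length_le hjα, wordProd_append, wordProd_append, mul_assoc] at hji
    have hv := mul_left_cancel hji
    have := cs.length_wordProd_le (β.eraseIdx (j - α.length))
    rw [List.length_eraseIdx_of_lt (by omega)] at this
    rw [IsRightDescent, hv, hβ.eq]
    omega

/-! ### Standard parabolic subgroups -/

/-- The standard parabolic subgroup generated by the simple reflections in `T`. -/
abbrev parabolic (T : Set B) : Subgroup W := Subgroup.closure (cs.simple '' T)

variable {T : Set B}

theorem simple_mem_parabolic {i : B} (hi : i ∈ T) : cs.simple i ∈ cs.parabolic T :=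
  Subgroup.subset_closure ⟨i, hi, rfl⟩

theorem wordProd_mem_parabolic {ω : List B} (hω : ∀ i ∈ ω, i ∈ T) :
    cs.wordProd ω ∈ cs.parabolic T := by
  induction ω with
  | nil => simp
  | cons i ω ih =>
    simp only [List.mem_cons, forall_eq_or_imp] at hω
    rw [wordProd_cons]
    exact mul_mem (cs.simple_mem_parabolic hω.1) (ih hω.2)

theorem exists_isReduced_of_mem_parabolic {w : W} (hw : w ∈ cs.parabolic T) :
    ∃ ω : List B, (∀ i ∈ ω, i ∈ T) ∧ cs.IsReduced ω ∧ w = cs.wordProd ω := by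
  have step : ∀ (x : W) (i : B), i ∈ T →
      (∃ ω : List B, (∀ i ∈ ω, i ∈ T) ∧ cs.IsReduced ω ∧ x = cs.wordProd ω) →
      ∃ ω : List B, (∀ i ∈ ω, i ∈ T) ∧ cs.IsReduced ω ∧ x * cs.simple i = cs.wordProd ω := by
    rintro x i hi ⟨ω, hT, hr, rfl⟩
    by_cases hd : cs.IsRightDescent (cs.wordProd ω) i
    · obtain ⟨j, hj, hji⟩ := cs.exists_eraseIdx_of_isRightDescent hd
      refine ⟨ω.eraseIdx j, fun k hk => hT k (List.mem_of_mem_eraseIdx hk), ?_, hji⟩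
      rw [isRightDescent_iff, hji, hr.eq] at hd
      rw [IsReduced, List.length_eraseIdx_of_lt hj]
      omega
    · refine ⟨ω ++ [i], ?_, ?_, by simp [wordProd_append]⟩
      · simp only [List.mem_append, List.mem_singleton]
        rintro k (hk | rfl)
        exacts [hT k hk, hi]
      · rw [not_isRightDescent_iff, hr.eq] at hd
        simpa [IsReduced, wordProd_append] using hd
  induction hw using Subgroup.closure_induction_right with
  | one => exact ⟨[], by simp, by simp [IsReduced], by simp⟩
  | mul_right x _ y hy ih =>
    obtain ⟨i, hi, rfl⟩ := hy
    exact step x i hi ih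
  | mul_inv_cancel x _ y hy ih =>
    obtain ⟨i, hi, rfl⟩ := hy
    rw [inv_simple]
    exact step x i hi ih

/-- Induction along right ascents inside a standard parabolic subgroup. -/
theorem parabolic_induction {p : W → Prop} (one : p 1)
    (mul : ∀ x ∈ cs.parabolic T, ∀ i ∈ T, ¬ cs.IsRightDescent x i → p x → p (x * cs.simple i))
    {w : W} (hw : w ∈ cs.parabolic T) : p w := by
  obtain ⟨ω, hT, hr, rfl⟩ := cs.exists_isReduced_of_mem_parabolic hw
  clear hw
  induction ω using List.reverseRecOn with
  | nil => simpa using one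
  | append_singleton ω i ih =>
    have hT' : ∀ k ∈ ω, k ∈ T := fun k hk => hT k (by simp [hk])
    have hr' : cs.IsReduced ω := by simpa using hr.take ω.length
    rw [wordProd_append, wordProd_singleton]
    refine mul _ (cs.wordProd_mem_parabolic hT') i (hT i (by simp)) ?_ (ih hT' hr')
    rw [not_isRightDescent_iff, hr'.eq]
    simpa [IsReduced, wordProd_append] using hr

/-- `u` has minimal length in its coset `u W_T`. -/
def IsMinCosetRep (T : Set B) (u : W) : Prop :=
  ∀ v ∈ cs.parabolic T, cs.length u ≤ cs.length (u * v)

variable {cs}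

theorem IsMinCosetRep.length_mul {u v : W} (hu : cs.IsMinCosetRep T u)
    (hv : v ∈ cs.parabolic T) : cs.length (u * v) = cs.length u + cs.length v := by
  refine cs.parabolic_induction (p := fun v => cs.length (u * v) = cs.length u + cs.length v)
    (by simp) ?_ hv
  intro x hx i hi hd ih
  have hud : ¬ cs.IsRightDescent (u * x) i := by
    intro h
    rcases cs.exchange_mul h with h | ⟨u', hu', he⟩
    · exact hd h
    · have h1 := hu (x * cs.simple i * x⁻¹)
        (mul_mem (mul_mem hx (cs.simple_mem_parabolic hi)) (inv_mem hx))
      rw [← mul_assoc, ← mul_assoc, he, mul_inv_cancel_right] at h1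
      omega
  rw [not_isRightDescent_iff] at hd hud
  rw [← mul_assoc, hud, hd, ih, add_assoc]

theorem IsMinCosetRep.eq_of_mul_eq {u u' v v' : W} (hu : cs.IsMinCosetRep T u)
    (hu' : cs.IsMinCosetRep T u') (hv : v ∈ cs.parabolic T) (hv' : v' ∈ cs.parabolic T)
    (h : u * v = u' * v') : u = u' ∧ v = v' := by
  have hx : v' * v⁻¹ ∈ cs.parabolic T := mul_mem hv' (inv_mem hv)
  have e : u' * (v' * v⁻¹) = u := by rw [← mul_assoc, ← h, mul_inv_cancel_right]
  have h1 := hu'.length_mul hx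
  have h2 := hu (v' * v⁻¹)⁻¹ (inv_mem hx)
  rw [e] at h1
  rw [← e, mul_inv_cancel_right, e] at h2
  have h3 : v' * v⁻¹ = 1 := cs.length_eq_zero_iff.mp (by omega)
  rw [h3, mul_one] at e
  exact ⟨e.symm, (mul_inv_eq_one.mp h3).symm⟩

variable (cs)

theorem exists_isMinCosetRep_mul (T : Set B) (w : W) :
    ∃ u v, cs.IsMinCosetRep T u ∧ v ∈ cs.parabolic T ∧ u * v = w := by
  let f : cs.parabolic T → ℕ := fun x => cs.length (w * x)
  obtain ⟨x, hx⟩ := (⟨Function.argmin f, fun y => Function.argmin_le f y⟩ :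
    ∃ x, ∀ y, f x ≤ f y)
  refine ⟨w * x, (x : W)⁻¹, fun v hv => ?_, inv_mem x.2, mul_inv_cancel_right w _⟩
  rw [mul_assoc]
  exact hx (x * ⟨v, hv⟩)

theorem length_mul_add_of_forall_isRightDescent {w x : W} (hw : ∀ i ∈ T, cs.IsRightDescent w i)
    (hx : x ∈ cs.parabolic T) : cs.length (w * x) + cs.length x = cs.length w := by
  suffices h : ∀ x ∈ cs.parabolic T, cs.length (w * x⁻¹) + cs.length x ≤ cs.length w by
    have h1 := h x⁻¹ (inv_mem hx)
    have h2 := cs.length_le_length_mul_add_right w x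
    rw [inv_inv, length_inv] at h1
    omega
  intro x hx
  refine cs.parabolic_induction
    (p := fun x => cs.length (w * x⁻¹) + cs.length x ≤ cs.length w) (by simp) ?_ hx
  intro x _ i hi hd ih
  have h := hw i hi
  nth_rw 1 [← inv_mul_cancel_right w x] at h
  rcases cs.exchange_mul h with h | ⟨u', hu', he⟩
  · exact absurd h hd
  · rw [inv_mul_cancel_right] at he
    have e : w * (x * cs.simple i)⁻¹ = u' := by
      rw [mul_inv_rev, inv_simple, ← mul_assoc, he, mul_inv_cancel_right]
    rw [not_isRightDescent_iff] at hd
    rw [e, hd]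
    omega

theorem finite_length_eq [Finite B] (n : ℕ) : {w : W | cs.length w = n}.Finite := by
  refine ((List.finite_length_eq B n).image cs.wordProd).subset ?_
  rintro w rfl
  obtain ⟨ω, hω, rfl⟩ := cs.exists_isReduced w
  exact ⟨ω, hω.symm, rfl⟩

theorem finite_parabolic_of_forall_isRightDescent [Finite B] {w : W}
    (hw : ∀ i ∈ T, cs.IsRightDescent w i) : (cs.parabolic T : Set W).Finite := by
  refine ((Set.finite_Iic (cs.length w)).biUnion fun n _ => cs.finite_length_eq n).subset ?_
  intro x hx
  have := cs.length_mul_add_of_forall_isRightDescent hw hx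
  simp only [Set.mem_iUnion, Set.mem_ofPred_eq, Set.mem_Iic]
  exact ⟨_, by omega, rfl⟩

/-! ### Growth series -/

/-- The generating series, by length, of the elements of `W` satisfying `p`. -/
noncomputable def growthSeries (p : W → Prop) : PowerSeries ℚ :=
  PowerSeries.mk fun n => (Nat.card {w : W // p w ∧ cs.length w = n} : ℚ)

instance [Finite B] (p : W → Prop) (n : ℕ) : Finite {w : W // p w ∧ cs.length w = n} :=
  ((cs.finite_length_eq n).subset fun _ h => h.2).to_subtype

theorem growthSeries_isMinCosetRep_mul [Finite B] (T : Set B) :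
    cs.growthSeries (cs.IsMinCosetRep T) * cs.growthSeries (· ∈ cs.parabolic T) =
      cs.growthSeries fun _ => True := by
  ext n
  rw [PowerSeries.coeff_mul]
  simp only [growthSeries, PowerSeries.coeff_mk]
  have key : Nat.card (Σ p : Finset.HasAntidiagonal.antidiagonal n,
      {u : W // cs.IsMinCosetRep T u ∧ cs.length u = p.1.1} ×
        {v : W // v ∈ cs.parabolic T ∧ cs.length v = p.1.2}) =
      Nat.card {w : W // True ∧ cs.length w = n} := by
    refine Nat.card_eq_of_bijective
      (fun x => ⟨x.2.1.1 * x.2.2.1, trivial, ?_⟩) ⟨?_, ?_⟩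
    · rw [x.2.1.2.1.length_mul x.2.2.2.1, x.2.1.2.2, x.2.2.2.2]
      exact Finset.HasAntidiagonal.mem_antidiagonal.mp x.1.2
    · rintro ⟨⟨⟨a, b⟩, hab⟩, ⟨u, hu, hua⟩, ⟨v, hv, hvb⟩⟩
        ⟨⟨⟨a', b'⟩, hab'⟩, ⟨u', hu', hua'⟩, ⟨v', hv', hvb'⟩⟩ h
      obtain ⟨rfl, rfl⟩ := hu.eq_of_mul_eq hu' hv hv' (congrArg Subtype.val h)
      obtain rfl : a = a' := hua.symm.trans hua'
      obtain rfl : b = b' := hvb.symm.trans hvb'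
      rfl
    · rintro ⟨w, -, rfl⟩
      obtain ⟨u, v, hu, hv, rfl⟩ := cs.exists_isMinCosetRep_mul T w
      exact ⟨⟨⟨(cs.length u, cs.length v), by simp [hu.length_mul hv]⟩,
        ⟨u, hu, rfl⟩, ⟨v, hv, rfl⟩⟩, rfl⟩
  rw [← key, Nat.card_sigma]
  simp only [Nat.card_prod]
  push_cast
  rw [← Finset.sum_coe_sort]

theorem constantCoeff_growthSeries {p : W → Prop} (h : p 1) :
    PowerSeries.constantCoeff (cs.growthSeries p) = 1 := by
  rw [← PowerSeries.coeff_zero_eq_constantCoeff_apply, growthSeries, PowerSeries.coeff_mk]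
  have : Nat.card {w : W // p w ∧ cs.length w = 0} = 1 := by
    rw [Nat.card_eq_one_iff_exists]
    refine ⟨⟨1, h, by simp⟩, ?_⟩
    rintro ⟨w, -, hw⟩
    exact Subtype.ext (cs.length_eq_zero_iff.mp hw)
  rw [this, Nat.cast_one]

theorem growthSeries_forall_isRightDescent {x : W} (hx : x ∈ cs.parabolic T)
    (hmax : ∀ v ∈ cs.parabolic T, cs.length v ≤ cs.length x) :
    cs.growthSeries (fun w => ∀ i ∈ T, cs.IsRightDescent w i) =
      PowerSeries.X ^ cs.length x * cs.growthSeries (cs.IsMinCosetRep T) := by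
  have hmin : ∀ w, (∀ i ∈ T, cs.IsRightDescent w i) → cs.IsMinCosetRep T (w * x) := by
    intro w hw v hv
    have h1 := cs.length_mul_add_of_forall_isRightDescent hw hx
    have h2 := cs.length_mul_add_of_forall_isRightDescent hw (mul_mem hx hv)
    have h3 := hmax _ (mul_mem hx hv)
    rw [← mul_assoc] at h2
    omega
  have hdesc : ∀ u, cs.IsMinCosetRep T u → ∀ i ∈ T, cs.IsRightDescent (u * x⁻¹) i := by
    intro u hu i hi
    have hxi := mul_mem (inv_mem hx) (cs.simple_mem_parabolic hi)
    have h1 := hmax _ hxi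
    refine lt_of_le_of_ne ?_ (cs.length_mul_simple_ne _ i)
    rw [hu.length_mul (inv_mem hx), mul_assoc, hu.length_mul hxi, length_inv]
    omega
  ext n
  rw [PowerSeries.coeff_X_pow_mul']
  simp only [growthSeries, PowerSeries.coeff_mk]
  split_ifs with hn
  · congr 1
    refine Nat.card_eq_of_bijective (fun w => ⟨w.1 * x, hmin _ w.2.1, ?_⟩) ⟨?_, ?_⟩
    · have := cs.length_mul_add_of_forall_isRightDescent w.2.1 hx
      have := w.2.2
      omega
    · intro w w' h
      exact Subtype.ext (mul_right_cancel (congrArg Subtype.val h))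
    · rintro ⟨u, hu, hun⟩
      refine ⟨⟨u * x⁻¹, hdesc u hu, ?_⟩, Subtype.ext (inv_mul_cancel_right u x)⟩
      rw [hu.length_mul (inv_mem hx), length_inv]
      omega
  · have : IsEmpty {w : W // (∀ i ∈ T, cs.IsRightDescent w i) ∧ cs.length w = n} := by
      refine ⟨fun ⟨w, hw, hwn⟩ => hn ?_⟩
      have := cs.length_mul_add_of_forall_isRightDescent hw hx
      omega
    simp

theorem growthSeries_eq_zero {p : W → Prop} (h : ∀ w, ¬ p w) : cs.growthSeries p = 0 := by
  ext n
  have : IsEmpty {w : W // p w ∧ cs.length w = n} := ⟨fun w => h _ w.2.1⟩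
  simp [growthSeries]

theorem sum_neg_one_pow_mul_growthSeries [Fintype B] :
    ∑ T : Finset B, (-1 : PowerSeries ℚ) ^ T.card *
      cs.growthSeries (fun w => ∀ i ∈ T, cs.IsRightDescent w i) = 1 := by
  classical
  ext n
  have hfin := cs.finite_length_eq n
  have hcard : ∀ p : W → Prop, (Nat.card {w : W // p w ∧ cs.length w = n} : ℚ) =
      ∑ w ∈ hfin.toFinset, if p w then 1 else 0 := by
    intro p
    rw [Finset.sum_boole, Nat.subtype_card]
    simp [and_comm]
  have hC : ∀ k : ℕ, (-1 : PowerSeries ℚ) ^ k = PowerSeries.C ((-1) ^ k) := by simp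
  have hsum : ∀ w, ∑ T : Finset B, (-1 : ℚ) ^ T.card *
      (if ∀ i ∈ T, cs.IsRightDescent w i then 1 else 0) = if w = 1 then 1 else 0 := by
    intro w
    have h := congrArg (Int.cast : ℤ → ℚ) (Finset.sum_powerset_neg_one_pow_card
      (x := Finset.univ.filter fun i => cs.IsRightDescent w i))
    have he : (Finset.univ.filter fun i => cs.IsRightDescent w i) = ∅ ↔ w = 1 := by
      constructor
      · intro h
        by_contra hw
        obtain ⟨i, hi⟩ := cs.exists_rightDescent_of_ne_one hw
        exact Finset.filter_eq_empty_iff.mp h (Finset.mem_univ i) hi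
      · rintro rfl
        simp [cs.not_isRightDescent_one]
    simp only [he] at h
    push_cast at h
    rw [← h]
    simp only [mul_ite, mul_one, mul_zero]
    rw [← Finset.sum_filter]
    refine Finset.sum_congr ?_ fun _ _ => rfl
    ext T
    simp [Finset.subset_iff]
  simp only [map_sum, hC, PowerSeries.coeff_C_mul, growthSeries, PowerSeries.coeff_mk, hcard]
  simp only [Finset.mul_sum]
  rw [Finset.sum_comm, Finset.sum_congr rfl fun w _ => (by convert hsum w)]
  simp [PowerSeries.coeff_one, eq_comm]

end CoxeterSystem

open scoped Classical in
/-- **`1/W(t) = Σ_{T ∈ 𝒮} (-1)^{Card T} t^{ℓ(w_T)} / W_T(t)`.**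
Let `(W, S)` be a Coxeter system with `S` finite, let `𝒮` be the set of spherical subsets
`T ⊆ S` (those for which the standard parabolic subgroup `W_T` is finite), and for `T ∈ 𝒮`
let `w_T` be the longest element of `W_T` (encoded by a function `wlong` such that for each
spherical `T`, `wlong T` lies in `W_T` and maximizes the length there).  Then in `ℚ⟦t⟧`:
`(Σ_{w ∈ W} t^{ℓ w})⁻¹ = Σ_{T ∈ 𝒮} (-1)^{Card T} · t^{ℓ(w_T)} · (Σ_{w ∈ W_T} t^{ℓ w})⁻¹`. -/
theorem growth_series_inverse_formula {B : Type*} [Fintype B] {W : Type*} [Group W]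
    {M : CoxeterMatrix B} (cs : CoxeterSystem M W)
    (wlong : Finset B → W)
    (hwlong : ∀ T : Finset B,
      ((Subgroup.closure (cs.simple '' ↑T) : Subgroup W) : Set W).Finite →
        wlong T ∈ Subgroup.closure (cs.simple '' ↑T) ∧
          ∀ v ∈ Subgroup.closure (cs.simple '' ↑T), cs.length v ≤ cs.length (wlong T)) :
    (PowerSeries.mk (fun n => (Nat.card {w : W // cs.length w = n} : ℚ)))⁻¹ =
      ∑ T ∈ Finset.univ.filter (fun T : Finset B =>
          ((Subgroup.closure (cs.simple '' ↑T) : Subgroup W) : Set W).Finite),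
        (-1 : PowerSeries ℚ) ^ T.card * PowerSeries.X ^ cs.length (wlong T) *
          (PowerSeries.mk (fun n =>
            (Nat.card {w : W //
              w ∈ Subgroup.closure (cs.simple '' ↑T) ∧ cs.length w = n} : ℚ)))⁻¹ := by
  have hC : ∀ T : Finset B, cs.growthSeries (cs.IsMinCosetRep (T : Set B)) =
      cs.growthSeries (fun _ => True) * (cs.growthSeries (· ∈ cs.parabolic (T : Set B)))⁻¹ := by
    intro T
    have h := cs.constantCoeff_growthSeries (p := (· ∈ cs.parabolic (T : Set B))) (one_mem _)
    rw [PowerSeries.eq_mul_inv_iff_mul_eq (by rw [h]; exact one_ne_zero)]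
    exact cs.growthSeries_isMinCosetRep_mul _
  have hW : PowerSeries.mk (fun n => (Nat.card {w : W // cs.length w = n} : ℚ)) =
      cs.growthSeries fun _ => True := by
    simp [CoxeterSystem.growthSeries]
  have h1 := cs.constantCoeff_growthSeries (p := fun _ => True) trivial
  rw [hW, eq_comm, PowerSeries.eq_inv_iff_mul_eq_one (by rw [h1]; exact one_ne_zero),
    Finset.sum_mul, Finset.sum_filter]
  refine Eq.trans ?_ cs.sum_neg_one_pow_mul_growthSeries
  refine Finset.sum_congr rfl fun T _ => ?_
  split_ifs with hT
  · obtain ⟨hmem, hmax⟩ := hwlong T hT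
    have h2 := cs.growthSeries_forall_isRightDescent (T := (T : Set B)) hmem hmax
    simp only [Finset.mem_coe] at h2
    rw [h2, hC]
    simp only [CoxeterSystem.growthSeries]
    ring
  · rw [cs.growthSeries_eq_zero, mul_zero]
    exact fun w hw => hT (cs.finite_parabolic_of_forall_isRightDescent (T := (T : Set B)) hw)
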